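/- For every integer l ≥ 0 and k = 2l + 1, the set of positions of the game W_k whose Sprague–Grundy value equals 1 is {(2i, 2i+1) : 0 ≤ i ≤ l} ∪ {(2i+1, 2i) : 0 ≤ i ≤ l} ∪ {(A_n + k + 1, B_n + k + 1) : n ≥ 0} ∪ {(B_n + k + 1, A_n + k + 1) : n ≥ 0}. -/

import Mathlib

noncomputable def phi : ℝ := (1 + Real.sqrt 5) / 2
noncomputable def wA (n : ℕ) : ℕ := ⌊phi * n⌋₊
noncomputable def wB (n : ℕ) : ℕ := ⌊phi ^ 2 * n⌋₊

/-- A legal move in the game `W_k` from `p` to `q`: a Nim move, or a diagonal move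
whose resulting smaller entry is at least `k`. -/
def WkMove (k : ℕ) (p q : ℕ × ℕ) : Prop :=
  (∃ t, 1 ≤ t ∧ t ≤ p.1 ∧ q = (p.1 - t, p.2)) ∨
  (∃ t, 1 ≤ t ∧ t ≤ p.2 ∧ q = (p.1, p.2 - t)) ∨
  (∃ s, 1 ≤ s ∧ s ≤ min p.1 p.2 ∧ k ≤ min (p.1 - s) (p.2 - s) ∧ q = (p.1 - s, p.2 - s))

/-- `S` is the set of P-positions of the game with move relation `move`. -/
def IsPPositions (move : ℕ × ℕ → ℕ × ℕ → Prop) (S : Set (ℕ × ℕ)) : Prop :=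
  (∀ p ∈ S, ∀ q ∈ S, ¬ move p q) ∧ (∀ p ∉ S, ∃ q ∈ S, move p q)

/-- `G` is the Sprague–Grundy function of the game with move relation `move`:
at every position, `G` takes the mex of the values of the options. -/
def IsGrundy (move : ℕ × ℕ → ℕ × ℕ → Prop) (G : ℕ × ℕ → ℕ) : Prop :=
  ∀ p, (∀ q, move p q → G q ≠ G p) ∧ (∀ v, v < G p → ∃ q, move p q ∧ G q = v)

/-- Every positive integer lies in exactly one of the two Wythoff sequences. -/
theorem wythoff_partition (m : ℕ) (hm : 0 < m) :
    Xor (∃ n, 0 < n ∧ wA n = m) (∃ n, 0 < n ∧ wB n = m) := by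
  have hφ : phi = Real.goldenRatio := rfl
  have hirr : Irrational phi := hφ ▸ Real.goldenRatio_irrational
  have h1 : 1 < phi := hφ ▸ Real.one_lt_goldenRatio
  have hsq : phi ^ 2 = phi + 1 := hφ ▸ Real.goldenRatio_sq
  have hconj : phi.HolderConjugate (phi ^ 2) := by
    rw [Real.holderConjugate_iff]
    refine ⟨h1, ?_⟩
    have h0 : phi ≠ 0 := by positivity
    field_simp
    linarith
  have key : ∀ r : ℝ, 0 < r → ((m : ℤ) ∈ {x | ∃ k > 0, beattySeq r k = x} ↔
      ∃ n : ℕ, 0 < n ∧ ⌊r * n⌋₊ = m) := by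
    intro r hr
    constructor
    · rintro ⟨k, hk, hkm⟩
      lift k to ℕ using hk.le
      refine ⟨k, by exact_mod_cast hk, ?_⟩
      rw [beattySeq, mul_comm] at hkm
      have : (0 : ℝ) ≤ r * k := by positivity
      have h := Int.natCast_floor_eq_floor this
      push_cast at hkm
      omega
    · rintro ⟨n, hn, hnm⟩
      refine ⟨n, by exact_mod_cast hn, ?_⟩
      have : (0 : ℝ) ≤ r * n := by positivity
      have h := Int.natCast_floor_eq_floor this
      rw [beattySeq, mul_comm]
      push_cast
      omega
  have hR := Irrational.beattySeq_symmDiff_beattySeq_pos hconj hirr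
  have hmem : (m : ℤ) ∈ {n : ℤ | 0 < n} := by
    simpa using hm
  rw [← hR, Set.mem_symmDiff, key _ (by positivity), key _ (by positivity)] at hmem
  exact hmem

theorem wB_eq (n : ℕ) : wB n = wA n + n := by
  have hsq : phi ^ 2 = phi + 1 := Real.goldenRatio_sq
  have h0 : 0 ≤ phi := Real.goldenRatio_pos.le
  rw [wB, wA, hsq, add_mul, one_mul, Nat.floor_add_natCast (by positivity)]

theorem wA_strictMono : StrictMono wA := by
  have h1 : 1 < phi := Real.one_lt_goldenRatio
  refine strictMono_nat_of_lt_succ fun n => ?_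
  rw [Nat.lt_iff_add_one_le, wA, wA, ← Nat.floor_add_one (by positivity)]
  apply Nat.floor_mono
  push_cast
  linarith

theorem wA_zero : wA 0 = 0 := by simp [wA]

/-- `(x, y)` is a P-position of Wythoff's game. -/
def WythoffPair (x y : ℕ) : Prop :=
  ∃ n, (x = wA n ∧ y = wB n) ∨ (x = wB n ∧ y = wA n)

theorem WythoffPair.symm {x y : ℕ} (h : WythoffPair x y) : WythoffPair y x := by
  obtain ⟨n, h | h⟩ := h
  exacts [⟨n, .inr h.symm⟩, ⟨n, .inl h.symm⟩]

theorem WythoffPair.exists_right (x : ℕ) : ∃ y, WythoffPair x y := by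
  rcases Nat.eq_zero_or_pos x with rfl | hx
  · exact ⟨wB 0, 0, .inl ⟨wA_zero.symm, rfl⟩⟩
  · obtain ⟨⟨n, -, hn⟩, -⟩ | ⟨⟨n, -, hn⟩, -⟩ := wythoff_partition x hx
    exacts [⟨wB n, n, .inl ⟨hn.symm, rfl⟩⟩, ⟨wA n, n, .inr ⟨hn.symm, rfl⟩⟩]

theorem eq_zero_of_wA_eq_wB {n m : ℕ} (h : wA n = wB m) : n = 0 ∧ m = 0 := by
  have hn := wA_strictMono.le_apply (x := n)
  have hB := wB_eq m
  rcases Nat.eq_zero_or_pos (wA n) with h0 | h0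
  · omega
  · have hn0 : 0 < n := Nat.pos_of_ne_zero (by rintro rfl; simp [wA_zero] at h0)
    have hm0 : 0 < m := by
      refine Nat.pos_of_ne_zero ?_
      rintro rfl
      simp [wA_zero] at hB
      omega
    obtain ⟨-, h'⟩ | ⟨-, h'⟩ := wythoff_partition (wA n) h0
    exacts [(h' ⟨m, hm0, h.symm⟩).elim, (h' ⟨n, hn0, rfl⟩).elim]

theorem WythoffPair.right_unique {x y z : ℕ} (hy : WythoffPair x y) (hz : WythoffPair x z) :
    y = z := by
  obtain ⟨n, ⟨h1, h2⟩ | ⟨h1, h2⟩⟩ := hy <;> obtain ⟨m, ⟨h3, h4⟩ | ⟨h3, h4⟩⟩ := hz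
  · have := wA_strictMono.injective (h1.symm.trans h3)
    subst this
    omega
  · obtain ⟨rfl, rfl⟩ := eq_zero_of_wA_eq_wB (h1.symm.trans h3)
    omega
  · obtain ⟨rfl, rfl⟩ := eq_zero_of_wA_eq_wB (h3.symm.trans h1)
    omega
  · have hmono : StrictMono wB := fun a b hab => by
      have := wA_strictMono hab
      rw [wB_eq, wB_eq]
      omega
    have := hmono.injective (h1.symm.trans h3)
    subst this
    omega

theorem WythoffPair.eq_of_add_eq {x y x' y' : ℕ} (h : WythoffPair x y) (h' : WythoffPair x' y')
    (hd : y + x' = y' + x) : x = x' := by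
  obtain ⟨n, hn⟩ := h
  obtain ⟨m, hm⟩ := h'
  have hBn := wB_eq n
  have hBm := wB_eq m
  have hnm : n = m := by omega
  subst hnm
  omega

theorem WythoffPair.exists_lt {x y d : ℕ} (h : WythoffPair x y) (hd : x + d < y) :
    ∃ z < x, WythoffPair z (z + d) := by
  obtain ⟨n, hn⟩ := h
  have hBn := wB_eq n
  have hlt : wA d < wA n := wA_strictMono (by omega)
  exact ⟨wA d, by omega, d, .inl ⟨rfl, (wB_eq d).symm⟩⟩

/-- The involution exchanging the two entries of each P-position of Wythoff's game. -/
noncomputable def wythoffPartner (x : ℕ) : ℕ := (WythoffPair.exists_right x).choose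

theorem wythoffPair_partner (x : ℕ) : WythoffPair x (wythoffPartner x) :=
  (WythoffPair.exists_right x).choose_spec

theorem wythoffPair_iff {x y : ℕ} : WythoffPair x y ↔ y = wythoffPartner x :=
  ⟨fun h => h.right_unique (wythoffPair_partner x), fun h => h ▸ wythoffPair_partner x⟩

theorem wythoffPartner_partner (x : ℕ) : wythoffPartner (wythoffPartner x) = x :=
  (wythoffPair_iff.1 (wythoffPair_partner x).symm).symm

theorem wythoffPartner_inj_diff {x x' : ℕ}
    (hd : wythoffPartner x + x' = wythoffPartner x' + x) : x = x' :=
  (wythoffPair_partner x).eq_of_add_eq (wythoffPair_partner x') hd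

theorem wythoffPartner_zero : wythoffPartner 0 = 0 :=
  (wythoffPair_iff.1 ⟨0, .inl ⟨wA_zero.symm, by simp [wB_eq, wA_zero]⟩⟩).symm

/-- The map equal to `h` below `c` and to the Wythoff involution shifted by `c` from `c` on. -/
noncomputable def shiftedPartner (c : ℕ) (h : ℕ → ℕ) (x : ℕ) : ℕ :=
  if x < c then h x else wythoffPartner (x - c) + c

section shiftedPartner

variable {c k : ℕ} {h : ℕ → ℕ}

theorem shiftedPartner_of_lt {x : ℕ} (hx : x < c) : shiftedPartner c h x = h x := if_pos hx

theorem shiftedPartner_add (x : ℕ) : shiftedPartner c h (x + c) = wythoffPartner x + c := by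
  simp [shiftedPartner]

theorem shiftedPartner_involutive (hlt : ∀ x < c, h x < c) (hinv : ∀ x < c, h (h x) = x) :
    Function.Involutive (shiftedPartner c h) := by
  intro x
  rcases lt_or_ge x c with hx | hx
  · rw [shiftedPartner_of_lt hx, shiftedPartner_of_lt (hlt x hx), hinv x hx]
  · obtain ⟨u, rfl⟩ := Nat.exists_eq_add_of_le' hx
    rw [shiftedPartner_add, shiftedPartner_add, wythoffPartner_partner]

/-- No move of `W_k` joins two points of the graph of `shiftedPartner c h`. -/
theorem not_move_shiftedPartner (hlt : ∀ x < c, h x < c) (hinv : ∀ x < c, h (h x) = x)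
    (hk : ∀ x < c, k ≤ x → h x < k) {p q : ℕ × ℕ} (hp : p.2 = shiftedPartner c h p.1)
    (hq : q.2 = shiftedPartner c h q.1) : ¬ WkMove k p q := by
  have hI := shiftedPartner_involutive hlt hinv
  obtain ⟨x, y⟩ := p
  dsimp only at hp
  rintro (⟨t, ht, htx, rfl⟩ | ⟨t, ht, hty, rfl⟩ | ⟨s, hs, hsx, hks, rfl⟩)
  · have := hI.injective (hp.symm.trans hq)
    simp only at htx
    omega
  · simp only at hq hty
    omega
  · simp only at hq hsx hks
    rcases lt_or_ge (x - s) c with hx | hx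
    · have := hk _ hx (by omega)
      rw [shiftedPartner_of_lt hx] at hq
      omega
    · obtain ⟨u, hu⟩ := Nat.exists_eq_add_of_le' hx
      obtain rfl : x = u + s + c := by omega
      rw [hu, shiftedPartner_add] at hq
      rw [shiftedPartner_add] at hp
      have := wythoffPartner_inj_diff (x := u + s) (x' := u) (by omega)
      omega

/-- Every point off the graph of `shiftedPartner c h`, apart from some points with both entries
below `c`, has a move of `W_k` to the graph. -/
theorem exists_move_shiftedPartner (hlt : ∀ x < c, h x < c) (hinv : ∀ x < c, h (h x) = x)
    (hkc : k ≤ c) {x y : ℕ} (hxy : y ≠ shiftedPartner c h x)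
    (hex : x < c → y < c → y < h x → h y ≤ x) :
    ∃ q : ℕ × ℕ, q.2 = shiftedPartner c h q.1 ∧ WkMove k (x, y) q := by
  have hI := shiftedPartner_involutive hlt hinv
  have hyx : x ≠ shiftedPartner c h y := fun e => hxy (by rw [e, hI])
  rcases lt_or_gt_of_ne hxy with h1 | h1
  swap
  · exact ⟨(x, shiftedPartner c h x), rfl, .inr (.inl ⟨y - shiftedPartner c h x, by omega, by simp,
      Prod.ext rfl (by dsimp only; omega)⟩)⟩
  rcases lt_or_gt_of_ne hyx with h2 | h2
  swap
  · exact ⟨(shiftedPartner c h y, y), (hI y).symm, .inl ⟨x - shiftedPartner c h y, by omega,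
      by simp, Prod.ext (by dsimp only; omega) rfl⟩⟩
  rcases lt_or_ge x c with hx | hx
  · rw [shiftedPartner_of_lt hx] at h1
    have hy : y < c := h1.trans (hlt x hx)
    rw [shiftedPartner_of_lt hy] at h2
    have := hex hx hy h1
    omega
  rcases lt_or_ge y c with hy | hy
  · rw [shiftedPartner_of_lt hy] at h2
    have := hlt y hy
    omega
  obtain ⟨u, rfl⟩ := Nat.exists_eq_add_of_le' hx
  obtain ⟨v, rfl⟩ := Nat.exists_eq_add_of_le' hy
  rw [shiftedPartner_add] at h1 h2
  rcases le_total u v with huv | huv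
  · obtain ⟨z, hz, hzd⟩ := (wythoffPair_partner u).exists_lt (d := v - u) (by omega)
    refine ⟨(z + c, z + (v - u) + c), ?_, .inr (.inr ⟨u - z, by omega, ?_, ?_, ?_⟩)⟩
    · rw [shiftedPartner_add, ← wythoffPair_iff.1 hzd]
    · simp only; omega
    · simp only; omega
    · simp only [Prod.mk.injEq]; omega
  · obtain ⟨z, hz, hzd⟩ := (wythoffPair_partner v).exists_lt (d := u - v) (by omega)
    refine ⟨(z + (u - v) + c, z + c), ?_, .inr (.inr ⟨v - z, by omega, ?_, ?_, ?_⟩)⟩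
    · rw [shiftedPartner_add, ← wythoffPair_iff.1 hzd.symm]
    · simp only; omega
    · simp only; omega
    · simp only [Prod.mk.injEq]; omega

end shiftedPartner

theorem WkMove.add_lt {k : ℕ} {p q : ℕ × ℕ} (h : WkMove k p q) : q.1 + q.2 < p.1 + p.2 := by
  rcases h with ⟨t, ht, hp, rfl⟩ | ⟨t, ht, hp, rfl⟩ | ⟨t, ht, hp, -, rfl⟩ <;> simp only <;> omega

/-- The positions of Grundy value `0` form the unique kernel of the move graph. -/
theorem IsGrundy.eq_zero_iff {k : ℕ} {G : ℕ × ℕ → ℕ} (hG : IsGrundy (WkMove k) G)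
    {S : Set (ℕ × ℕ)} (hS : IsPPositions (WkMove k) S) (p : ℕ × ℕ) : G p = 0 ↔ p ∈ S := by
  induction hn : p.1 + p.2 using Nat.strong_induction_on generalizing p with
  | _ n ih =>
    subst hn
    constructor
    · intro h0
      by_contra hp
      obtain ⟨q, hq, hpq⟩ := hS.2 p hp
      exact (hG p).1 q hpq (((ih _ hpq.add_lt q rfl).2 hq).trans h0.symm)
    · intro hp
      by_contra h0
      obtain ⟨q, hpq, hq⟩ := (hG p).2 0 (Nat.pos_of_ne_zero h0)
      exact hS.1 p hp q ((ih _ hpq.add_lt q rfl).1 hq) hpq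

/-- The positions of Grundy value `1` form the kernel of the game in which the positions of
Grundy value `0` are removed. -/
theorem IsGrundy.eq_one_iff {k : ℕ} {G : ℕ × ℕ → ℕ} (hG : IsGrundy (WkMove k) G)
    {S : Set (ℕ × ℕ)} (hS0 : ∀ p ∈ S, G p ≠ 0) (hS : ∀ p ∈ S, ∀ q ∈ S, ¬ WkMove k p q)
    (hS' : ∀ p ∉ S, G p ≠ 0 → ∃ q ∈ S, WkMove k p q) (p : ℕ × ℕ) : G p = 1 ↔ p ∈ S := by
  induction hn : p.1 + p.2 using Nat.strong_induction_on generalizing p with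
  | _ n ih =>
    subst hn
    constructor
    · intro h1
      by_contra hp
      obtain ⟨q, hq, hpq⟩ := hS' p hp (by omega)
      exact (hG p).1 q hpq (((ih _ hpq.add_lt q rfl).2 hq).trans h1.symm)
    · intro hp
      by_contra h1
      have h0 := hS0 p hp
      obtain ⟨q, hpq, hq⟩ := (hG p).2 1 (by omega)
      exact hS p hp q ((ih _ hpq.add_lt q rfl).1 hq) hpq

/-- The involution of `ℕ` exchanging `2 * i` and `2 * i + 1`. -/
def paritySwap (x : ℕ) : ℕ := if x % 2 = 0 then x + 1 else x - 1

theorem Wk_odd_grundy_one (l : ℕ) (G : ℕ × ℕ → ℕ) (hG : IsGrundy (WkMove (2 * l + 1)) G) :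
    {p : ℕ × ℕ | G p = 1} =
      {p : ℕ × ℕ | ∃ i, i ≤ l ∧ p = (2 * i, 2 * i + 1)} ∪
      {p : ℕ × ℕ | ∃ i, i ≤ l ∧ p = (2 * i + 1, 2 * i)} ∪
      {p : ℕ × ℕ | ∃ n, p = (wA n + (2 * l + 1) + 1, wB n + (2 * l + 1) + 1)} ∪
      {p : ℕ × ℕ | ∃ n, p = (wB n + (2 * l + 1) + 1, wA n + (2 * l + 1) + 1)} := by
  have hS0 : IsPPositions (WkMove (2 * l + 1))
      {p | p.2 = shiftedPartner (2 * l + 1) id p.1} := by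
    refine ⟨fun p hp q hq => not_move_shiftedPartner (fun _ h => h) (fun _ _ => rfl)
      (fun x hx hkx => by omega) hp hq, fun p hp => ?_⟩
    exact exists_move_shiftedPartner (fun _ h => h) (fun _ _ => rfl) le_rfl hp
      fun _ _ h => h.le
  have hzero := hG.eq_zero_iff hS0
  have hlt : ∀ x < 2 * l + 1 + 1, paritySwap x < 2 * l + 1 + 1 := by
    intro x hx
    unfold paritySwap
    split_ifs <;> omega
  have hinv : ∀ x < 2 * l + 1 + 1, paritySwap (paritySwap x) = x := by
    intro x hx
    unfold paritySwap
    split_ifs <;> omega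
  have hone := hG.eq_one_iff (S := {p | p.2 = shiftedPartner (2 * l + 1 + 1) paritySwap p.1}) ?_
    (fun p hp q hq => not_move_shiftedPartner hlt hinv ?_ hp hq) ?_
  · ext ⟨x, y⟩
    rw [Set.mem_ofPred_eq, hone]
    simp only [Set.mem_union, Set.mem_ofPred_eq, Prod.mk.injEq]
    rcases lt_or_ge x (2 * l + 1 + 1) with hx | hx
    · rw [shiftedPartner_of_lt hx]
      constructor
      · intro hy
        left; left
        unfold paritySwap at hy
        split_ifs at hy with hpar
        · exact .inl ⟨x / 2, by omega, by omega, by omega⟩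
        · exact .inr ⟨x / 2, by omega, by omega, by omega⟩
      · unfold paritySwap
        rintro (((⟨i, hi, rfl, rfl⟩ | ⟨i, hi, rfl, rfl⟩) | ⟨n, hn, -⟩) | ⟨n, hn, -⟩)
        · simp
        · rw [if_neg (by omega)]
          rfl
        · omega
        · omega
    · obtain ⟨u, rfl⟩ := Nat.exists_eq_add_of_le' hx
      rw [shiftedPartner_add]
      constructor
      · rintro rfl
        obtain ⟨n, ⟨h1, h2⟩ | ⟨h1, h2⟩⟩ := wythoffPair_partner u
        · exact .inl (.inr ⟨n, by omega, by omega⟩)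
        · exact .inr ⟨n, by omega, by omega⟩
      · rintro (((⟨i, hi, h, -⟩ | ⟨i, hi, h, -⟩) | ⟨n, hn, rfl⟩) | ⟨n, hn, rfl⟩)
        · omega
        · omega
        · have := wythoffPair_iff.1 (⟨n, .inl ⟨by omega, rfl⟩⟩ : WythoffPair u (wB n))
          omega
        · have := wythoffPair_iff.1 (⟨n, .inr ⟨by omega, rfl⟩⟩ : WythoffPair u (wA n))
          omega
  · rintro ⟨x, y⟩ hp h0
    rw [hzero] at h0
    simp only [Set.mem_ofPred_eq] at hp h0
    rw [hp] at h0
    rcases lt_trichotomy x (2 * l + 1) with hx | rfl | hx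
    · rw [shiftedPartner_of_lt hx, shiftedPartner_of_lt (by omega), paritySwap] at h0
      simp only [id] at h0
      split_ifs at h0 <;> omega
    · rw [shiftedPartner_of_lt (by omega), shiftedPartner, if_neg (by omega), Nat.sub_self,
        wythoffPartner_zero, paritySwap, if_neg (by omega)] at h0
      omega
    · obtain ⟨u, rfl⟩ := Nat.exists_eq_add_of_le' hx
      rw [Nat.succ_eq_add_one, shiftedPartner_add,
        show u + (2 * l + 1 + 1) = u + 1 + (2 * l + 1) by omega, shiftedPartner_add] at h0
      have := wythoffPartner_inj_diff (x := u) (x' := u + 1) (by omega)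
      omega
  · intro x hx hkx
    obtain rfl : x = 2 * l + 1 := by omega
    rw [paritySwap, if_neg (by omega)]
    omega
  · rintro ⟨x, y⟩ hp h0
    refine exists_move_shiftedPartner hlt hinv (by omega) hp fun hx hy hyx => ?_
    by_contra! hxy
    refine h0 ((hzero _).2 ?_)
    have hpar : x = y ∧ x % 2 = 0 := by
      unfold paritySwap at hyx hxy
      split_ifs at hyx hxy <;> omega
    simp only [Set.mem_ofPred_eq]
    rw [shiftedPartner_of_lt (by omega), id, hpar.1]
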